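/- Let q(x,y) = A·x² + B·x·y + C·y² be a primitive, Minkowski reduced (|B| ≤ A ≤ C), positive definite integral binary quadratic form with discriminant D = A·C − B²/4, let Q be a positive definite integral quadratic form in 4 variables, let p be an odd prime with v_p(D) = 0, and let n ∈ ℕ with p^{4n} ≤ √D. Then: (i) there is an absolute constant κ such that the number of x ∈ 𝒮(n) with C·x1 − A·x4 = 0 and A·(x2+x3) − B·x1 = 0 is at most κ·√D·p^{−4n}; and (ii) an element x ∈ 𝒮(n) satisfies C·x1 − A·x4 = 0 and A·(x2+x3) − B·x1 = 0 if and only if (C·x1 − A·x4)² + (B·x1 − A·(x2+x3))·(B·x4 − C·(x2+x3)) = 0. -/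

import Mathlib

open Matrix

noncomputable section

/-- Congruence of rationals modulo `p^k`: `v_p(a − b) ≥ k` (with `v_p(0) = ∞`). -/
def PCong (p k : ℕ) (a b : ℚ) : Prop :=
  a = b ∨ (k : ℤ) ≤ padicValRat p (a - b)

/-- `M` is the Gram matrix of a positive definite integral quadratic form in `n` variables. -/
def IsIntegralPosDefForm {n : ℕ} (M : Matrix (Fin n) (Fin n) ℚ) : Prop :=
  M.IsSymm ∧ (∀ i, ∃ z : ℤ, M i i = z) ∧ (∀ i j, ∃ z : ℤ, 2 * M i j = z) ∧
    ∀ v : Fin n → ℚ, v ≠ 0 → 0 < v ⬝ᵥ M.mulVec v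

/-- Membership conditions for the set `𝒮(n)`. -/
def SMem (MQ : Matrix (Fin 4) (Fin 4) ℚ) (A B C : ℤ) (p n : ℕ)
    (x0 x1 x2 x3 x4 : ℚ) : Prop :=
  -- half-integrality
  (∃ z : ℤ, 2 * x0 = z) ∧ (∃ z : ℤ, 2 * x1 = z) ∧ (∃ z : ℤ, 2 * x2 = z) ∧
    (∃ z : ℤ, 2 * x3 = z) ∧ (∃ z : ℤ, 2 * x4 = z) ∧
  -- (E) the degree four equation
  MQ.det * x0 ^ 2 =
    (x1 * x4 - x2 * x3 - ((A : ℚ) * C - (B : ℚ) ^ 2 / 4)) ^ 2 -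
      ((C : ℚ) * x1 - (A : ℚ) * x4) ^ 2 -
      ((B : ℚ) * x1 - (A : ℚ) * (x2 + x3)) * ((B : ℚ) * x4 - (C : ℚ) * (x2 + x3)) ∧
  -- (S1) archimedean constraints
  |x1| ≤ (A : ℚ) ∧ |x4| ≤ (C : ℚ) ∧ x2 ^ 2 ≤ (A : ℚ) * C ∧ x3 ^ 2 ≤ (A : ℚ) * C ∧
  -- (S2) congruence constraints mod `p^(4n)`
  PCong p (4 * n) (x1 * x4 - x2 * x3) ((A : ℚ) * C - (B : ℚ) ^ 2 / 4) ∧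
  PCong p (4 * n) ((C : ℚ) * x1) ((A : ℚ) * x4) ∧
  PCong p (4 * n) ((C : ℚ) * (x2 + x3)) ((B : ℚ) * x4) ∧
  PCong p (4 * n) ((A : ℚ) * (x2 + x3)) ((B : ℚ) * x1) ∧
  -- (S3) boundary conditions
  ((x1 = (A : ℚ) ∨ x4 = (C : ℚ)) → x0 = 0 ∧ x2 = (B : ℚ) / 2 ∧ x3 = (B : ℚ) / 2) ∧
  ((x1 = -(A : ℚ) ∨ x4 = -(C : ℚ)) → x0 = 0 ∧ x2 = -((B : ℚ) / 2) ∧ x3 = -((B : ℚ) / 2))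

/-- The set `𝒮(n)` of half-integral tuples `(x0, x1, x2, x3, x4)`. -/
def SSetQ (MQ : Matrix (Fin 4) (Fin 4) ℚ) (A B C : ℤ) (p n : ℕ) : Set (Fin 5 → ℚ) :=
  {x | SMem MQ A B C p n (x 0) (x 1) (x 2) (x 3) (x 4)}

/-- A positive definite binary quadratic form vanishes only at the origin. -/
theorem eq_zero_of_posDef_binary {A B C X Y : ℚ} (hA : 0 < A) (hD : 0 < A * C - B ^ 2 / 4)
    (h : A * X ^ 2 + B * X * Y + C * Y ^ 2 = 0) : X = 0 ∧ Y = 0 := by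
  have hsum : (2 * A * X + B * Y) ^ 2 + 4 * ((A * C - B ^ 2 / 4) * Y ^ 2) = 0 := by
    linear_combination 4 * A * h
  have hY : Y = 0 := by
    by_contra hY
    have : 0 < (A * C - B ^ 2 / 4) * Y ^ 2 := by positivity
    nlinarith [sq_nonneg (2 * A * X + B * Y)]
  subst hY
  have hX : A * X ^ 2 = 0 := by linear_combination h
  simpa [hA.ne'] using hX

/-- If `C x₁ - A x₄`, `A s - B x₁`, `C s - B x₄` come from a positive definite form `⟨A, B, C⟩`,
then the first two vanish exactly when the quadratic expression in them does. -/
theorem linear_relations_iff {A B C x₁ x₄ s : ℚ} (hA : 0 < A) (hD : 0 < A * C - B ^ 2 / 4) :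
    (C * x₁ - A * x₄ = 0 ∧ A * s - B * x₁ = 0) ↔
      (C * x₁ - A * x₄) ^ 2 + (B * x₁ - A * s) * (B * x₄ - C * s) = 0 := by
  constructor
  · rintro ⟨h₁, h₂⟩
    linear_combination (C * x₁ - A * x₄) * h₁ - (B * x₄ - C * s) * h₂
  · intro h
    refine eq_zero_of_posDef_binary hA hD ?_
    linear_combination A * h

/-- The determinant of a positive definite Gram matrix does not vanish. -/
theorem IsIntegralPosDefForm.det_ne_zero {n : ℕ} {M : Matrix (Fin n) (Fin n) ℚ}
    (hM : IsIntegralPosDefForm M) : M.det ≠ 0 := by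
  intro h
  obtain ⟨v, hv, hMv⟩ := Matrix.exists_mulVec_eq_zero_iff.mpr h
  have := hM.2.2.2 v hv
  simp [hMv] at this

/-- For odd `p`, a congruence modulo `p ^ k` between rationals whose difference has denominator
dividing `16` is a divisibility of integers. -/
theorem PCong.dvd {p k : ℕ} (hp : p.Prime) (hp2 : p ≠ 2) {a b : ℚ} (h : PCong p k a b) {z : ℤ}
    (hz : 16 * (a - b) = z) : (p : ℤ) ^ k ∣ z := by
  have := Fact.mk hp
  rcases h with rfl | h
  · have : z = 0 := by
      have : (z : ℚ) = 0 := by rw [← hz]; ring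
      exact_mod_cast this
    simp [this]
  · rw [padicValInt_dvd_iff]
    by_cases hz0 : z = 0
    · exact Or.inl hz0
    right
    have h16 : padicValRat p (16 : ℚ) = 0 := by
      have : padicValNat p 16 = 0 := by
        refine padicValNat.eq_zero_of_not_dvd fun hd => hp2 ?_
        exact (Nat.prime_dvd_prime_iff_eq hp Nat.prime_two).mp
          (hp.dvd_of_dvd_pow (show p ∣ 2 ^ 4 from hd))
      exact_mod_cast congrArg (Nat.cast : ℕ → ℤ) this
    have hab : a - b = (z : ℚ) / 16 := by rw [← hz]; ring
    rw [hab, padicValRat.div (by exact_mod_cast hz0) (by norm_num), h16, padicValRat.of_int] at h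
    simpa using h

/-- An integer `m` with `v_p (m / 4) = 0` is prime to the odd prime `p`. -/
theorem not_dvd_of_padicValRat_div_four {p : ℕ} (hp : p.Prime) (hp2 : p ≠ 2) {m : ℤ} (hm : m ≠ 0)
    (h : padicValRat p ((m : ℚ) / 4) = 0) : ¬ (p : ℤ) ∣ m := by
  have := Fact.mk hp
  have h4 : padicValRat p (4 : ℚ) = 0 := by
    have : padicValNat p 4 = 0 := by
      refine padicValNat.eq_zero_of_not_dvd fun hd => hp2 ?_
      exact (Nat.prime_dvd_prime_iff_eq hp Nat.prime_two).mp
        (hp.dvd_of_dvd_pow (show p ∣ 2 ^ 2 from hd))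
    exact_mod_cast congrArg (Nat.cast : ℕ → ℤ) this
  rw [padicValRat.div (by exact_mod_cast hm) (by norm_num), h4, padicValRat.of_int] at h
  intro hd
  have := (padicValInt_dvd_iff (p := p) 1 m).mp (by simpa using hd)
  have h0 : padicValInt p m = 0 := by simpa using h
  omega

/-- Two square roots of the same unit modulo an odd prime power agree up to sign. -/
theorem dvd_sub_or_dvd_add_of_sq_congr {p k : ℕ} (hp : p.Prime) (hp2 : p ≠ 2) {m v w : ℤ}
    (hm : k = 0 ∨ ¬ (p : ℤ) ∣ m) (hv : (p : ℤ) ^ k ∣ v ^ 2 - m) (hw : (p : ℤ) ^ k ∣ w ^ 2 - m) :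
    (p : ℤ) ^ k ∣ w - v ∨ (p : ℤ) ^ k ∣ w + v := by
  rcases Nat.eq_zero_or_pos k with rfl | hk
  · simp
  have hm : ¬ (p : ℤ) ∣ m := hm.resolve_left hk.ne'
  have hpZ : Prime (p : ℤ) := Nat.prime_iff_prime_int.mp hp
  have hmul : (p : ℤ) ^ k ∣ (w - v) * (w + v) := by
    have := dvd_sub hw hv
    have he : w ^ 2 - m - (v ^ 2 - m) = (w - v) * (w + v) := by ring
    rwa [he] at this
  have hnot : ¬ ((p : ℤ) ∣ w - v ∧ (p : ℤ) ∣ w + v) := by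
    rintro ⟨h₁, h₂⟩
    have h2w : (p : ℤ) ∣ 2 * w := by
      have := dvd_add h₁ h₂
      have he : w - v + (w + v) = 2 * w := by ring
      rwa [he] at this
    rcases hpZ.dvd_or_dvd h2w with h | h
    · have : p ∣ 2 := by exact_mod_cast h
      exact hp2 ((Nat.prime_dvd_prime_iff_eq hp Nat.prime_two).mp this)
    · apply hm
      have := dvd_sub (dvd_pow h two_ne_zero) ((dvd_pow_self (p : ℤ) hk.ne').trans hw)
      simpa using this
  by_cases h₁ : (p : ℤ) ∣ w - v
  · exact Or.inl (hpZ.pow_dvd_of_dvd_mul_right k (fun h => hnot ⟨h₁, h⟩) hmul)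
  · exact Or.inr (hpZ.pow_dvd_of_dvd_mul_left k h₁ hmul)

/-- A residue class modulo `r` meets `[-N, N]` in at most `(2 N + 1) / r + 1` integers. -/
theorem card_modEq_le {N r : ℤ} (hN : 0 ≤ N) (hr : 0 < r) (v : ℤ) :
    (({x ∈ Finset.Ioc (-N - 1) N | x ≡ v [ZMOD r]} : Finset ℤ).card : ℝ) ≤
      (2 * N + 1) / r + 1 := by
  have hr' : (0 : ℝ) < r := by exact_mod_cast hr
  have hN' : (0 : ℝ) ≤ N := by exact_mod_cast hN
  have h := Int.Ioc_filter_modEq_card (-N - 1) N hr v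
  have hq : ((({x ∈ Finset.Ioc (-N - 1) N | x ≡ v [ZMOD r]} : Finset ℤ).card : ℤ) : ℚ) ≤
      (2 * N + 1) / r + 1 := by
    rw [h]
    have hrq : (0 : ℚ) < r := by exact_mod_cast hr
    have hNq : (0 : ℚ) ≤ N := by exact_mod_cast hN
    push_cast
    refine max_le ?_ (by positivity)
    have h₁ := Int.floor_le (((N : ℚ) - v) / r)
    have h₂ := Int.lt_floor_add_one (((-N - 1 : ℚ) - v) / r)
    have h₃ : ((N : ℚ) - v) / r - ((-N - 1 : ℚ) - v) / r = (2 * N + 1) / r := by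
      rw [← sub_div]; ring
    linarith
  exact_mod_cast hq

/-- The square roots of `m` modulo `r` in the interval `[-N, N]`. -/
def sqrtWindow (N r m : ℤ) : Finset ℤ := {w ∈ Finset.Ioc (-N - 1) N | r ∣ w ^ 2 - m}

theorem card_sqrtWindow_le {p k : ℕ} (hp : p.Prime) (hp2 : p ≠ 2) {N m : ℤ} (hN : 0 ≤ N)
    (hm : k = 0 ∨ ¬ (p : ℤ) ∣ m) :
    ((sqrtWindow N ((p : ℤ) ^ k) m).card : ℝ) ≤ 2 * ((2 * N + 1) / (p : ℝ) ^ k + 1) := by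
  have hr : (0 : ℤ) < (p : ℤ) ^ k := by have := hp.pos; positivity
  have hN' : (0 : ℝ) ≤ N := by exact_mod_cast hN
  rcases (sqrtWindow N ((p : ℤ) ^ k) m).eq_empty_or_nonempty with h | ⟨v, hv⟩
  · rw [h]; simp; positivity
  have hv := (Finset.mem_filter.mp hv).2
  have hsub : sqrtWindow N ((p : ℤ) ^ k) m ⊆
      {x ∈ Finset.Ioc (-N - 1) N | x ≡ v [ZMOD (p : ℤ) ^ k]} ∪
        {x ∈ Finset.Ioc (-N - 1) N | x ≡ -v [ZMOD (p : ℤ) ^ k]} := by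
    intro w hw
    obtain ⟨hw₁, hw₂⟩ := Finset.mem_filter.mp hw
    rw [Finset.mem_union, Finset.mem_filter, Finset.mem_filter]
    rcases dvd_sub_or_dvd_add_of_sq_congr hp hp2 hm hv hw₂ with h | h
    · exact Or.inl ⟨hw₁, (Int.modEq_iff_dvd.mpr h).symm⟩
    · exact Or.inr ⟨hw₁, (Int.modEq_iff_dvd.mpr (by simpa using h)).symm⟩
  have hcard := (Finset.card_le_card hsub).trans (Finset.card_union_le _ _)
  have h₁ := card_modEq_le hN hr v
  have h₂ := card_modEq_le hN hr (-v)
  push_cast at h₁ h₂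
  rw [← Nat.cast_le (α := ℝ)] at hcard
  push_cast at hcard
  linarith

/-- The number of square roots of `d (4 - T²)` modulo `p ^ (4 n)` in an interval, for `T² < 4`;
the case `p = 3`, `T = ± 1` is the one where the residue is not a unit. -/
theorem card_sqrtWindow_mul_le {p n : ℕ} (hp : p.Prime) (hp2 : p ≠ 2) {N d T : ℤ} (hN : 0 ≤ N)
    (hd : ¬ (p : ℤ) ∣ d) (hT : T ^ 2 < 4) :
    ((sqrtWindow N ((p : ℤ) ^ (4 * n)) (d * (4 - T ^ 2))).card : ℝ) ≤
      2 * ((2 * N + 1) / (p : ℝ) ^ (4 * n) + 1) := by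
  have hN' : (0 : ℝ) ≤ N := by exact_mod_cast hN
  have hpZ : Prime (p : ℤ) := Nat.prime_iff_prime_int.mp hp
  by_cases hm : 4 * n = 0 ∨ ¬ (p : ℤ) ∣ d * (4 - T ^ 2)
  · exact card_sqrtWindow_le hp hp2 hN hm
  push Not at hm
  obtain ⟨hn, hm⟩ := hm
  have hdvd := (hpZ.dvd_or_dvd hm).resolve_left hd
  have hT' : T ^ 2 = 0 ∨ T ^ 2 = 1 := by
    have h₁ : -2 < T := by nlinarith
    have h₂ : T < 2 := by nlinarith
    interval_cases T <;> simp
  rcases hT' with hT' | hT'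
  · rw [hT'] at hdvd
    have : p ∣ 2 ^ 2 := by exact_mod_cast (show (p : ℤ) ∣ 2 ^ 2 by simpa using hdvd)
    exact absurd ((Nat.prime_dvd_prime_iff_eq hp Nat.prime_two).mp (hp.dvd_of_dvd_pow this)) hp2
  · rw [hT'] at hdvd
    have h3 : p = 3 := by
      have : p ∣ 3 := by exact_mod_cast (show (p : ℤ) ∣ 3 by simpa using hdvd)
      exact (Nat.prime_dvd_prime_iff_eq hp Nat.prime_three).mp this
    subst h3
    have hempty : sqrtWindow N (((3 : ℕ) : ℤ) ^ (4 * n)) (d * (4 - T ^ 2)) = ∅ := by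
      refine Finset.eq_empty_of_forall_notMem fun w hw => ?_
      have hw := (Finset.mem_filter.mp hw).2
      have h9 : (9 : ℤ) ∣ w ^ 2 - d * 3 := by
        rw [hT'] at hw
        exact (pow_dvd_pow (3 : ℤ) (show 2 ≤ 4 * n by omega)).trans hw
      have hw3 : (3 : ℤ) ∣ w := by
        refine Int.prime_three.dvd_of_dvd_pow (n := 2) ?_
        omega
      obtain ⟨c, rfl⟩ := hw3
      apply hd
      have he : (3 * c) ^ 2 = 9 * c ^ 2 := by ring
      rw [he] at h9
      push_cast
      omega
    rw [hempty]
    simp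
    positivity

/-- A solution of the two linear relations is proportional to a primitive `(A, B, C)`. -/
theorem exists_multiplier {A B C a s c : ℤ} (hA : A ≠ 0) (hgcd : Int.gcd (Int.gcd A B) C = 1)
    (h₁ : C * a = A * c) (h₂ : A * s = B * a) :
    ∃ T : ℤ, a = A * T ∧ s = B * T ∧ c = C * T := by
  have h₃ : C * s = B * c := by
    apply mul_left_cancel₀ hA
    linear_combination C * h₂ + B * h₁
  obtain ⟨u, v, hb₁⟩ : ∃ u v : ℤ, (Int.gcd A B : ℤ) = A * u + B * v :=
    ⟨_, _, Int.gcd_eq_gcd_ab A B⟩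
  obtain ⟨y, z, hb₂⟩ : ∃ y z : ℤ, (Int.gcd (Int.gcd A B) C : ℤ) = Int.gcd A B * y + C * z :=
    ⟨_, _, Int.gcd_eq_gcd_ab _ C⟩
  rw [hgcd, hb₁] at hb₂
  push_cast at hb₂
  refine ⟨u * y * a + v * y * s + z * c, ?_, ?_, ?_⟩
  · linear_combination a * hb₂ - v * y * h₂ + z * h₁
  · linear_combination s * hb₂ + u * y * h₂ + z * h₃
  · linear_combination c * hb₂ - u * y * h₁ - v * y * h₃

/-- The equation `a y² = b` with `a ≠ 0` determines `y` up to sign. -/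
theorem exists_eq_or_eq_neg_of_mul_sq {a : ℚ} (ha : a ≠ 0) (b : ℚ) :
    ∃ g : ℚ, ∀ y, a * y ^ 2 = b → y = 1 * g ∨ y = -1 * g := by
  by_cases h : ∃ g, a * g ^ 2 = b
  · obtain ⟨g, hg⟩ := h
    refine ⟨g, fun y hy => ?_⟩
    have := mul_left_cancel₀ ha (hy.trans hg.symm)
    simpa using sq_eq_sq_iff_eq_or_eq_neg.mp this
  · exact ⟨0, fun y hy => absurd ⟨y, hy⟩ h⟩

/-- The degenerate elements of `𝒮(n)` are parametrized by an integer `T` with `|T| ≤ 2` and a square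
root `w` of `(4 A C - B²) (4 - T²)` modulo `p ^ (4 n)`, up to the sign of `x₀`. -/
theorem SMem.exists_parameters {MQ : Matrix (Fin 4) (Fin 4) ℚ} {A B C : ℤ} {p n : ℕ}
    {x0 x1 x2 x3 x4 : ℚ} (hx : SMem MQ A B C p n x0 x1 x2 x3 x4) (hA : 0 < A)
    (hgcd : Int.gcd (Int.gcd A B) C = 1) (hp : p.Prime) (hp2 : p ≠ 2)
    (h₁ : (C : ℚ) * x1 - A * x4 = 0) (h₂ : (A : ℚ) * (x2 + x3) - B * x1 = 0) :
    ∃ T w : ℤ, |T| ≤ 2 ∧ (T ^ 2 = 4 → w = 0) ∧ w ^ 2 ≤ 16 * (A * C) ∧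
      (p : ℤ) ^ (4 * n) ∣ w ^ 2 - (4 * (A * C) - B ^ 2) * (4 - T ^ 2) ∧
      x1 = A * T / 2 ∧ x2 = B * T / 4 + w / 4 ∧ x3 = B * T / 4 - w / 4 ∧ x4 = C * T / 2 ∧
      MQ.det * x0 ^ 2 =
        ((w : ℚ) ^ 2 / 16 - ((A : ℚ) * C - (B : ℚ) ^ 2 / 4) * (1 - (T : ℚ) ^ 2 / 4)) ^ 2 := by
  obtain ⟨-, ⟨a, ha⟩, ⟨b, hb⟩, ⟨c, hc⟩, ⟨d, hd⟩, hE, hx1, -, hx2, hx3, hcong, -, -, -, hpos, hneg⟩ :=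
    hx
  have hAq : (0 : ℚ) < A := by exact_mod_cast hA
  obtain ⟨T, haT, hsT, hdT⟩ := exists_multiplier (a := a) (s := b + c) (c := d) hA.ne' hgcd
    (by qify; rw [← ha, ← hd]; linear_combination 2 * h₁)
    (by qify; rw [← ha, ← hb, ← hc]; linear_combination 2 * h₂)
  qify at haT hsT hdT
  have e1 : x1 = A * T / 2 := by linear_combination (ha + haT) / 2
  have e4 : x4 = C * T / 2 := by linear_combination (hd + hdT) / 2
  have e2 : x2 = B * T / 4 + ((b - c : ℤ) : ℚ) / 4 := by
    push_cast; linear_combination (2 * hb + hsT) / 4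
  have e3 : x3 = B * T / 4 - ((b - c : ℤ) : ℚ) / 4 := by
    push_cast; linear_combination (2 * hc + hsT) / 4
  have hw : ((b - c : ℤ) : ℚ) = 2 * x2 - 2 * x3 := by push_cast; rw [hb, hc]
  refine ⟨T, b - c, ?_, ?_, ?_, ?_, e1, e2, e3, e4, ?_⟩
  · rw [e1, mul_div_assoc, abs_mul, abs_of_pos hAq] at hx1
    have : |(T : ℚ) / 2| ≤ 1 := by nlinarith
    rw [abs_div, abs_of_pos (two_pos : (0 : ℚ) < 2), div_le_one two_pos] at this
    exact_mod_cast this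
  · intro hT
    have : (T - 2) * (T + 2) = 0 := by linear_combination hT
    have hz : ((b - c : ℤ) : ℚ) = 0 := by
      rcases mul_eq_zero.mp this with h | h
      · have hT2 : (T : ℚ) = 2 := by exact_mod_cast (show T = 2 by omega)
        obtain ⟨-, h2, h3⟩ := hpos (Or.inl (by rw [e1, hT2]; ring))
        rw [hw, h2, h3]; ring
      · have hT2 : (T : ℚ) = -2 := by exact_mod_cast (show T = -2 by omega)
        obtain ⟨-, h2, h3⟩ := hneg (Or.inl (by rw [e1, hT2]; ring))
        rw [hw, h2, h3]; ring
    exact_mod_cast hz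
  · have : ((b - c : ℤ) : ℚ) ^ 2 ≤ 16 * (A * C) := by
      rw [hw]; nlinarith [sq_nonneg (x2 + x3)]
    exact_mod_cast this
  · refine hcong.dvd hp hp2 ?_
    rw [e1, e2, e3, e4]
    push_cast
    ring
  · rw [hE, e1, e2, e3, e4]
    ring

/-- There is an absolute constant `κ` such that for every primitive
Minkowski-reduced positive definite integral binary form `q = ⟨A,B,C⟩` of discriminant `D`,
every positive definite integral quaternary form `Q`, every odd prime `p` with
`v_p(D) = 0` and every `n` with `p^(4n) ≤ √D`:
(i) the number of `x ∈ 𝒮(n)` with `C·x1 − A·x4 = 0` and `A·(x2+x3) − B·x1 = 0` is at most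
`κ·√D·p^(−4n)`; and
(ii) `x ∈ 𝒮(n)` satisfies these two equations if and only if
`(C·x1 − A·x4)² + (B·x1 − A·(x2+x3))·(B·x4 − C·(x2+x3)) = 0`. -/
theorem degenerate_SSet_bound :
    ∃ κ : ℝ, ∀ (MQ : Matrix (Fin 4) (Fin 4) ℚ), IsIntegralPosDefForm MQ →
      ∀ A B C : ℤ, 0 < A → |B| ≤ A → A ≤ C →
        0 < (A : ℚ) * C - (B : ℚ) ^ 2 / 4 →
        Int.gcd (Int.gcd A B) C = 1 →
        ∀ p : ℕ, p.Prime → p ≠ 2 →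
          padicValRat p ((A : ℚ) * C - (B : ℚ) ^ 2 / 4) = 0 →
          ∀ n : ℕ, (p : ℝ) ^ (4 * n) ≤
              Real.sqrt (((A : ℚ) * C - (B : ℚ) ^ 2 / 4 : ℚ) : ℝ) →
            (({x ∈ SSetQ MQ A B C p n |
                  (C : ℚ) * x 1 - (A : ℚ) * x 4 = 0 ∧
                    (A : ℚ) * (x 2 + x 3) - (B : ℚ) * x 1 = 0}).ncard : ℝ) ≤
                κ * Real.sqrt (((A : ℚ) * C - (B : ℚ) ^ 2 / 4 : ℚ) : ℝ) /
                  (p : ℝ) ^ (4 * n) ∧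
              ∀ x ∈ SSetQ MQ A B C p n,
                (((C : ℚ) * x 1 - (A : ℚ) * x 4 = 0 ∧
                    (A : ℚ) * (x 2 + x 3) - (B : ℚ) * x 1 = 0) ↔
                  ((C : ℚ) * x 1 - (A : ℚ) * x 4) ^ 2 +
                      ((B : ℚ) * x 1 - (A : ℚ) * (x 2 + x 3)) *
                        ((B : ℚ) * x 4 - (C : ℚ) * (x 2 + x 3)) = 0) := by
  refine ⟨240, fun MQ hMQ A B C hA hB hAC hD hgcd p hp hp2 hval n hn => ⟨?_, fun x _ => ?_⟩⟩
  swap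
  · exact linear_relations_iff (by exact_mod_cast hA) hD
  set D : ℚ := (A : ℚ) * C - (B : ℚ) ^ 2 / 4 with hDdef
  set R : ℝ := Real.sqrt (D : ℝ) with hR
  set P : ℝ := (p : ℝ) ^ (4 * n) with hP
  set d : ℤ := 4 * (A * C) - B ^ 2 with hd
  have hdD : (d : ℚ) = 4 * D := by rw [hd, hDdef]; push_cast; ring
  have hd0 : d ≠ 0 := by
    intro h
    rw [h] at hdD
    push_cast at hdD
    linarith
  have hpd : ¬ (p : ℤ) ∣ d :=
    not_dvd_of_padicValRat_div_four hp hp2 hd0 (by rw [hdD, mul_div_cancel_left₀ _ four_ne_zero,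
      hval])
  have hP1 : 1 ≤ P := one_le_pow₀ (by exact_mod_cast hp.one_le)
  have hR1 : 1 ≤ R := hP1.trans hn
  have hRP : 1 ≤ R / P := (one_le_div (by linarith)).mpr hn
  have hRsq : R ^ 2 = (D : ℝ) := Real.sq_sqrt (by exact_mod_cast hD.le)
  have hBAC : B ^ 2 ≤ A * C := by
    have : B ^ 2 ≤ A ^ 2 := sq_le_sq.mpr (by rwa [abs_of_pos hA])
    nlinarith
  set N : ℤ := ⌊5 * R⌋ with hNdef
  have hN0 : 0 ≤ N := Int.floor_nonneg.mpr (by linarith)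
  have hNle : (N : ℝ) ≤ 5 * R := Int.floor_le _
  choose g hg using fun T w : ℤ => exists_eq_or_eq_neg_of_mul_sq hMQ.det_ne_zero
    (((w : ℚ) ^ 2 / 16 - D * (1 - (T : ℚ) ^ 2 / 4)) ^ 2)
  let W : ℤ → Finset ℤ := fun T =>
    if T ^ 2 = 4 then {0} else sqrtWindow N ((p : ℤ) ^ (4 * n)) (d * (4 - T ^ 2))
  let f : (Σ _ : ℤ, ℤ) × ℚ → (Fin 5 → ℚ) := fun y =>
    ![y.2 * g y.1.1 y.1.2, A * y.1.1 / 2, B * y.1.1 / 4 + y.1.2 / 4,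
      B * y.1.1 / 4 - y.1.2 / 4, C * y.1.1 / 2]
  let F : Finset (Fin 5 → ℚ) := (((Finset.Icc (-2) 2).sigma W) ×ˢ ({1, -1} : Finset ℚ)).image f
  have hW : ∀ T ∈ Finset.Icc (-2 : ℤ) 2, ((W T).card : ℝ) ≤ 24 * (R / P) := by
    intro T hT
    rw [Finset.mem_Icc] at hT
    by_cases hT4 : T ^ 2 = 4
    · simp only [W, if_pos hT4, Finset.card_singleton, Nat.cast_one]
      linarith
    · simp only [W, if_neg hT4]
      have hlt : T ^ 2 < 4 := lt_of_le_of_ne (by nlinarith) hT4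
      refine (card_sqrtWindow_mul_le hp hp2 hN0 hpd hlt).trans ?_
      have : (2 * (N : ℝ) + 1) / P ≤ 11 * (R / P) := by
        rw [← mul_div_assoc]
        gcongr
        linarith
      linarith
  have hFcard : (F.card : ℝ) ≤ 240 * R / P := by
    have h₁ : F.card ≤ (∑ T ∈ Finset.Icc (-2 : ℤ) 2, (W T).card) * 2 := by
      refine Finset.card_image_le.trans ?_
      rw [Finset.card_product, Finset.card_sigma]
      exact Nat.mul_le_mul_left _ Finset.card_le_two
    have h₂ : ∑ T ∈ Finset.Icc (-2 : ℤ) 2, ((W T).card : ℝ) ≤ 5 * (24 * (R / P)) := by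
      refine (Finset.sum_le_card_nsmul _ _ _ hW).trans_eq ?_
      simp
    have h₃ : (F.card : ℝ) ≤ (∑ T ∈ Finset.Icc (-2 : ℤ) 2, ((W T).card : ℝ)) * 2 := by
      exact_mod_cast h₁
    rw [mul_div_assoc]
    linarith
  have hsub : {x ∈ SSetQ MQ A B C p n | (C : ℚ) * x 1 - (A : ℚ) * x 4 = 0 ∧
      (A : ℚ) * (x 2 + x 3) - (B : ℚ) * x 1 = 0} ⊆ (F : Set (Fin 5 → ℚ)) := by
    rintro x ⟨hx, hx₁, hx₂⟩
    obtain ⟨T, w, hT, hT4, hw, hdvd, e1, e2, e3, e4, e0⟩ :=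
      SMem.exists_parameters hx hA hgcd hp hp2 hx₁ hx₂
    have hwN : |w| ≤ N := by
      refine Int.le_floor.mpr ?_
      push_cast
      refine abs_le_of_sq_le_sq ?_ (by linarith)
      have : (w : ℚ) ^ 2 ≤ 25 * D := by
        have hq : (w : ℚ) ^ 2 ≤ 16 * (A * C) := by exact_mod_cast hw
        have hq' : (B : ℚ) ^ 2 ≤ A * C := by exact_mod_cast hBAC
        rw [hDdef]
        nlinarith [sq_nonneg (B : ℚ)]
      rw [mul_pow, hRsq]
      norm_num
      exact_mod_cast this
    have hwW : w ∈ W T := by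
      by_cases h : T ^ 2 = 4
      · simp [W, h, hT4 h]
      · simp only [W, if_neg h, sqrtWindow, Finset.mem_filter, Finset.mem_Ioc]
        rw [abs_le] at hwN
        exact ⟨⟨by omega, hwN.2⟩, hdvd⟩
    obtain ⟨ε, hε, hx0⟩ : ∃ ε ∈ ({1, -1} : Finset ℚ), x 0 = ε * g T w := by
      rcases hg T w (x 0) e0 with h | h
      · exact ⟨1, by simp, h⟩
      · exact ⟨-1, by simp, h⟩
    refine Finset.mem_coe.mpr (Finset.mem_image.mpr ⟨(⟨T, w⟩, ε), ?_, ?_⟩)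
    · exact Finset.mem_product.mpr ⟨Finset.mem_sigma.mpr
        ⟨Finset.mem_Icc.mpr (abs_le.mp hT), hwW⟩, hε⟩
    · funext i
      fin_cases i
      · exact hx0.symm
      · exact e1.symm
      · exact e2.symm
      · exact e3.symm
      · exact e4.symm
  refine le_trans ?_ hFcard
  exact_mod_cast (Set.ncard_le_ncard hsub F.finite_toSet).trans_eq (Set.ncard_coe_finset F)
end
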